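/- In any regular decreasing path in D, every edge given by an ordinary legal move and every edge given by an exceptional move has degree 0. -/

import Mathlib

/-- A weight diagram: a finitely supported function `f : ℕ → ℕ` with `f t ≤ 1` for `t > 0`.
`f t` is the number of crosses at position `t`; position `0` is the tail position. -/
def IsWeightDiagram (f : ℕ → ℕ) : Prop :=
  (Function.support f).Finite ∧ ∀ t : ℕ, 0 < t → f t ≤ 1

/-- `|f| = 2·f(0) + c`, where `c ∈ {0,1}` is the number of core symbols at the tail. -/
def wsize (c : ℕ) (f : ℕ → ℕ) : ℤ := 2 * (f 0 : ℤ) + (c : ℤ)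

/-- `l_f(s,u)`: the number of positions `r` with `s < r < u` and `f r = 1` minus the
number of positions `r` with `s < r < u` and `f r = 0`. -/
def lval (f : ℕ → ℕ) (s u : ℕ) : ℤ :=
  (((Finset.Ioo s u).filter fun r => f r = 1).card : ℤ) -
    (((Finset.Ioo s u).filter fun r => f r = 0).card : ℤ)

/-- `f_s^t`: the diagram obtained from `f` by decreasing its value at `s` by 1 and
increasing its value at `t` by 1. -/
def moveX (f : ℕ → ℕ) (s t : ℕ) : ℕ → ℕ :=
  fun r => if r = s then f s - 1 else if r = t then f t + 1 else f r

/-- An ordinary legal move on `f` with start `s`, end `t` and degree `w`. -/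
structure OrdinaryMove (c : ℕ) (f : ℕ → ℕ) (s t : ℕ) (w : ℕ) : Prop where
  lt : s < t
  startCross : 1 ≤ f s
  endZero : f t = 0
  tailC : s = 0 → c = 0
  nonneg : ∀ u : ℕ, s < u → u ≤ t → 0 ≤ lval f s u
  degEq : (w : ℤ) = lval f s t

/-- A tail legal move on `f` with end `t` and degree `w`; it produces `g = f_0^t`. -/
structure TailMove (c : ℕ) (f : ℕ → ℕ) (t : ℕ) (w : ℕ) : Prop where
  pos : 0 < t
  startCross : 1 ≤ f 0
  endZero : f t = 0
  mid : ∀ u : ℕ, 0 < u → u < t → 0 < wsize c (moveX f 0 t) + lval f 0 u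
  nonneg : 0 ≤ wsize c (moveX f 0 t) + lval f 0 t
  degEq : (w : ℤ) = wsize c (moveX f 0 t) + lval f 0 t

/-- An exceptional move on `f` with intermediate position `s`, end `t` and degree `w`;
it produces `g = (f_0^s)_0^t`. -/
structure ExceptionalMove (c : ℕ) (f : ℕ → ℕ) (s t : ℕ) (w : ℕ) : Prop where
  sPos : 0 < s
  lt : s < t
  sZero : f s = 0
  endZero : f t = 0
  twoCrosses : 2 ≤ f 0
  left : ∀ a : ℕ, a < s → lval f a s ≤ 0
  oddPos : 0 < wsize c (moveX (moveX f 0 s) 0 t) + lval f 0 s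
  odd : Odd (wsize c (moveX (moveX f 0 s) 0 t) + lval f 0 s)
  mid : ∀ u : ℕ, s < u → u ≤ t → 0 ≤ lval f s u
  degEq : (w : ℤ) = lval f s t

/-- The edges of the graph `D` with source `f`: one edge for each ordinary legal move,
tail legal move or exceptional move on `f`. -/
inductive Move (c : ℕ) (f : ℕ → ℕ) : Type
  | ordinary (s t w : ℕ) (h : OrdinaryMove c f s t w) : Move c f
  | tail (t w : ℕ) (h : TailMove c f t w) : Move c f
  | exceptional (s t w : ℕ) (h : ExceptionalMove c f s t w) : Move c f

namespace Move

/-- The diagram produced by a move. -/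
def target {c : ℕ} {f : ℕ → ℕ} : Move c f → (ℕ → ℕ)
  | ordinary s t _ _ => moveX f s t
  | tail t _ _ => moveX f 0 t
  | exceptional s t _ _ => moveX (moveX f 0 s) 0 t

/-- The end position of a move. -/
def endPos {c : ℕ} {f : ℕ → ℕ} : Move c f → ℕ
  | ordinary _ t _ _ => t
  | tail t _ _ => t
  | exceptional _ t _ _ => t

/-- The degree of a move. -/
def deg {c : ℕ} {f : ℕ → ℕ} : Move c f → ℕ
  | ordinary _ _ w _ => w
  | tail _ w _ => w
  | exceptional _ _ w _ => w

end Move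

/-- Paths in the graph `D`: finite sequences of composable edges. -/
inductive DPath (c : ℕ) : (ℕ → ℕ) → (ℕ → ℕ) → Type
  | nil (f : ℕ → ℕ) : DPath c f f
  | cons {f g : ℕ → ℕ} (m : Move c f) (p : DPath c m.target g) : DPath c f g

namespace DPath

/-- The degree `l(R)` of a path: the sum of the degrees of its edges. -/
def deg {c : ℕ} : {f g : ℕ → ℕ} → DPath c f g → ℕ
  | _, _, nil _ => 0
  | _, _, cons m p => m.deg + p.deg

/-- The number `|R|` of edges of a path. -/
def length {c : ℕ} : {f g : ℕ → ℕ} → DPath c f g → ℕ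
  | _, _, nil _ => 0
  | _, _, cons _ p => p.length + 1

/-- The list of ends of the successive edges of a path. -/
def ends {c : ℕ} : {f g : ℕ → ℕ} → DPath c f g → List ℕ
  | _, _, nil _ => []
  | _, _, cons m p => m.endPos :: p.ends

/-- A path is decreasing if the ends of its successive edges strictly decrease. -/
def Decreasing {c : ℕ} {f g : ℕ → ℕ} (p : DPath c f g) : Prop :=
  p.ends.Chain' (· > ·)

/-- A path is increasing if the ends of its successive edges strictly increase. -/
def Increasing {c : ℕ} {f g : ℕ → ℕ} (p : DPath c f g) : Prop :=
  p.ends.Chain' (· < ·)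

end DPath

/-- `(s,t)` is a cap of `f`: `s > 0` and there is an ordinary legal move of degree `0`
on `f` with start `s` and end `t`. -/
def IsCap (c : ℕ) (f : ℕ → ℕ) (s t : ℕ) : Prop :=
  0 < s ∧ OrdinaryMove c f s t 0

/-- A non-tail position `u` is free for `f` if `f u = 0` and `u` is not the end of a cap. -/
def IsFree (c : ℕ) (f : ℕ → ℕ) (u : ℕ) : Prop :=
  0 < u ∧ f u = 0 ∧ ∀ s : ℕ, ¬ IsCap c f s u

/-- A move is regular relative to the initial diagram `μ`: an ordinary move must go along
a cap of `μ`, and a tail or exceptional move must end at a position free for `μ`. -/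
def Move.Regular {c : ℕ} {f : ℕ → ℕ} (μ : ℕ → ℕ) : Move c f → Prop
  | .ordinary s t _ _ => IsCap c μ s t
  | .tail t _ _ => IsFree c μ t
  | .exceptional _ t _ _ => IsFree c μ t

/-- A path is regular relative to the initial diagram `μ` if all its edges are. -/
def DPath.RegularFrom {c : ℕ} (μ : ℕ → ℕ) : {f g : ℕ → ℕ} → DPath c f g → Prop
  | _, _, .nil _ => True
  | _, _, .cons m p => m.Regular μ ∧ p.RegularFrom μ


/-- A move is an ordinary or exceptional move of degree zero, or a tail move. -/
def Move.OrdExcDegZero {c : ℕ} {f : ℕ → ℕ} : Move c f → Prop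
  | .ordinary _ _ w _ => w = 0
  | .tail _ _ _ => True
  | .exceptional _ _ w _ => w = 0

/-- Every ordinary or exceptional edge of the path has degree zero. -/
def DPath.OrdExcDegZero {c : ℕ} : {f g : ℕ → ℕ} → DPath c f g → Prop
  | _, _, .nil _ => True
  | _, _, .cons m p => m.OrdExcDegZero ∧ p.OrdExcDegZero

/-- The contribution of a position holding `n` crosses to `lval`. -/
def crossSign (n : ℕ) : ℤ := (if n = 1 then 1 else 0) - (if n = 0 then 1 else 0)

theorem lval_eq_sum (f : ℕ → ℕ) (s u : ℕ) :
    lval f s u = ∑ r ∈ Finset.Ioo s u, crossSign (f r) := by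
  simp [lval, crossSign, Finset.sum_sub_distrib]

theorem lval_self_succ (f : ℕ → ℕ) (s : ℕ) : lval f s (s + 1) = 0 := by
  have h : Finset.Ioo s (s + 1) = ∅ := by ext; simp
  rw [lval_eq_sum, h, Finset.sum_empty]

theorem lval_succ (f : ℕ → ℕ) {s m : ℕ} (h : s < m) :
    lval f s (m + 1) = lval f s m + crossSign (f m) := by
  have hI : Finset.Ioo s (m + 1) = insert m (Finset.Ioo s m) := by
    ext; simp; omega
  rw [lval_eq_sum, lval_eq_sum, hI, Finset.sum_insert (by simp), add_comm]

theorem lval_split (f : ℕ → ℕ) {s m u : ℕ} (hs : s < m) (hu : m < u) :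
    lval f s u = lval f s m + crossSign (f m) + lval f m u := by
  induction u, hu using Nat.le_induction with
  | base => rw [lval_succ f hs, Nat.succ_eq_add_one, lval_self_succ, add_zero]
  | succ u hu ih =>
    rw [lval_succ f (show s < u by omega), lval_succ f (show m < u by omega), ih, add_assoc]

theorem lval_congr {f g : ℕ → ℕ} {s u : ℕ} (h : ∀ r, s < r → r < u → f r = g r) :
    lval f s u = lval g s u := by
  rw [lval_eq_sum, lval_eq_sum]
  refine Finset.sum_congr rfl fun r hr => ?_
  rw [Finset.mem_Ioo] at hr
  rw [h r hr.1 hr.2]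

theorem IsFree.lval_nonpos {c : ℕ} {f : ℕ → ℕ} {t : ℕ} (h : IsFree c f t) {s : ℕ} (hs : s < t) :
    lval f s t ≤ 0 := by
  obtain ⟨-, ht, hcap⟩ := h
  induction hk : t - s using Nat.strong_induction_on generalizing s with
  | _ k ih =>
    by_contra! hpos
    have hright : ∀ a, s < a → a < t → lval f a t ≤ 0 := fun a ha hat =>
      ih (t - a) (by omega) hat rfl
    have hst : s + 1 < t := by
      by_contra hle
      obtain rfl : t = s + 1 := by omega
      rw [lval_self_succ] at hpos
      exact lt_irrefl _ hpos
    have hsplit := lval_split f (Nat.lt_succ_self s) hst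
    rw [Nat.succ_eq_add_one, lval_self_succ] at hsplit
    have hnext := hright (s + 1) (by omega) hst
    have hone : f (s + 1) = 1 := by
      by_contra hne
      simp only [crossSign, if_neg hne] at hsplit
      split_ifs at hsplit <;> omega
    have hzero : lval f (s + 1) t = 0 := by
      simp only [crossSign, hone] at hsplit
      norm_num at hsplit
      omega
    refine hcap (s + 1) ⟨by omega, hst, hone.ge, ht, by omega, fun u hu hut => ?_, ?_⟩
    · rcases hut.eq_or_lt with rfl | hut
      · exact hzero.ge
      obtain ⟨v, rfl⟩ : ∃ v, u = v + 1 := ⟨u - 1, by omega⟩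
      rcases (Nat.lt_succ_iff.mp hu).eq_or_lt with rfl | hv
      · rw [lval_self_succ]
      have h1 := lval_split f hv (show v < t by omega)
      have h2 := lval_succ f hv
      have h3 := hright v (by omega) (by omega)
      omega
    · rw [hzero]; rfl

/-- A free position cannot be passed by a segment on which `lval` stays nonnegative. -/
theorem IsFree.lval_succ_neg {c : ℕ} {f : ℕ → ℕ} {s t : ℕ} (h : IsFree c f t) (hs : s < t) :
    lval f s (t + 1) < 0 := by
  have h1 := lval_succ f hs
  have h2 := h.lval_nonpos hs
  simp only [crossSign, h.2.1] at h1
  norm_num at h1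
  omega

theorem IsCap.lval_pred_pos {c : ℕ} {f : ℕ → ℕ} (hf : IsWeightDiagram f) {s t r : ℕ}
    (h : IsCap c f s t) (hs : s < r) (hr : r ≤ t) : 0 < lval f (s - 1) r := by
  obtain ⟨hpos, hm⟩ := h
  have h1 := lval_split f (show s - 1 < s by omega) hs
  have h2 := lval_self_succ f (s - 1)
  rw [Nat.sub_add_cancel hpos] at h2
  have h3 := hm.nonneg r hs hr
  have hone : f s = 1 := le_antisymm (hf.2 s hpos) hm.startCross
  simp only [crossSign, hone] at h1
  norm_num at h1
  omega

/-- A cap starting inside another cap also ends inside it. -/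
theorem IsCap.end_le {c : ℕ} {f : ℕ → ℕ} (hf : IsWeightDiagram f) {s t s' t' : ℕ}
    (h : IsCap c f s t) (h' : IsCap c f s' t') (hs : s ≤ s') (hst : s' < t) : t' ≤ t := by
  by_contra! hlt
  have hdeg := h.2.degEq
  rcases hs.eq_or_lt with rfl | hs
  · have h1 := lval_succ f h.2.lt
    have h2 := h'.2.nonneg (t + 1) (by omega) hlt
    simp only [crossSign, h.2.endZero] at h1
    norm_num at h1
    omega
  · have h1 := lval_split f hs hst
    have h2 := h.2.nonneg s' hs hst.le
    have h3 := h'.2.nonneg t hst hlt.le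
    have hone : f s' = 1 := le_antisymm (hf.2 s' h'.1) h'.2.startCross
    simp only [crossSign, hone] at h1
    norm_num at h1
    omega

/-- How the diagram `f` reached by a regular decreasing path from `μ` whose last end is `T` still
agrees with `μ` to the left of `T`. -/
structure AgreesBelow (c : ℕ) (μ f : ℕ → ℕ) (T : ℕ) : Prop where
  cap : ∀ s t, IsCap c μ s t → t < T → ∀ r, s ≤ r → r < t → f r = μ r
  free : ∀ t, IsFree c μ t → t < T → f t = 0 → ∀ r, 0 < r → r < t → f r = μ r

theorem AgreesBelow.refl (c : ℕ) (μ : ℕ → ℕ) (T : ℕ) : AgreesBelow c μ μ T :=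
  ⟨fun _ _ _ _ _ _ _ => rfl, fun _ _ _ _ _ _ _ => rfl⟩

theorem moveX_of_ne {f : ℕ → ℕ} {s t r : ℕ} (hs : r ≠ s) (ht : r ≠ t) : moveX f s t r = f r := by
  simp [moveX, hs, ht]

theorem moveX_end {f : ℕ → ℕ} {s t : ℕ} (h : t ≠ s) : moveX f s t t = f t + 1 := by
  simp [moveX, h]

theorem AgreesBelow.target {c : ℕ} {μ f : ℕ → ℕ} {T : ℕ} (hμ : IsWeightDiagram μ)
    (h : AgreesBelow c μ f T) (m : Move c f) (hreg : m.Regular μ) (hT : m.endPos < T) :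
    AgreesBelow c μ m.target m.endPos := by
  cases m with
  | ordinary s t w hm =>
    change IsCap c μ s t at hreg
    change t < T at hT
    change AgreesBelow c μ (moveX f s t) t
    constructor
    · intro s₂ t₂ hcap hlt r hr hrt
      rw [moveX_of_ne _ (by omega)]
      · exact h.cap s₂ t₂ hcap (by omega) r hr hrt
      · rintro rfl
        have := hcap.end_le hμ hreg hr hrt
        omega
    · intro t₂ hfree hlt hz r hr hrt
      have hle : t₂ ≤ s := by
        by_contra! hst
        have h1 := hfree.lval_succ_neg hst
        have h2 := hreg.2.nonneg (t₂ + 1) (by omega) hlt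
        omega
      have hne : t₂ ≠ s := by
        rintro rfl
        have h1 := hfree.2.1
        have h2 := hreg.2.startCross
        omega
      rw [moveX_of_ne hne (by omega)] at hz
      rw [moveX_of_ne (by omega) (by omega)]
      exact h.free t₂ hfree (by omega) hz r hr hrt
  | tail t w hm =>
    change t < T at hT
    change AgreesBelow c μ (moveX f 0 t) t
    constructor
    · intro s₂ t₂ hcap hlt r hr hrt
      have hpos := hcap.1
      rw [moveX_of_ne (by omega) (by omega)]
      exact h.cap s₂ t₂ hcap (by omega) r hr hrt
    · intro t₂ hfree hlt hz r hr hrt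
      rw [moveX_of_ne (by omega) (by omega)] at hz ⊢
      exact h.free t₂ hfree (by omega) hz r hr hrt
  | exceptional s t w hm =>
    change IsFree c μ t at hreg
    change t < T at hT
    change AgreesBelow c μ (moveX (moveX f 0 s) 0 t) t
    have hagree := h.free t hreg hT hm.endZero
    have hsPos := hm.sPos
    have hmove : ∀ r, 0 < r → r < t → r ≠ s → moveX (moveX f 0 s) 0 t r = f r := by
      intro r hr hrt hne
      rw [moveX_of_ne (by omega) (by omega), moveX_of_ne (by omega) hne]
    constructor
    · intro s₂ t₂ hcap hlt r hr hrt
      have hpos := hcap.1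
      rw [hmove r (by omega) (by omega)]
      · exact hagree r (by omega) (by omega)
      rintro rfl
      have hne : s₂ ≠ r := by
        rintro rfl
        have h1 := hagree s₂ hpos (by omega)
        have h2 := hm.sZero
        have h3 := hcap.2.startCross
        omega
      have h1 := hcap.lval_pred_pos hμ (show s₂ < r by omega) hrt.le
      have h2 := hm.left (s₂ - 1) (by omega)
      rw [lval_congr fun q hq hqr => hagree q (by omega) (by omega)] at h2
      omega
    · intro t₂ hfree hlt hz r hr hrt
      have hne : t₂ ≠ s := by
        rintro rfl
        rw [moveX_of_ne (by omega) (by omega), moveX_end (by omega)] at hz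
        omega
      have hle : t₂ ≤ s := by
        by_contra! hst
        have h1 := hfree.lval_succ_neg hst
        have h2 := hm.mid (t₂ + 1) (by omega) hlt
        rw [lval_congr fun q hq hqr => hagree q (by omega) (by omega)] at h2
        omega
      rw [hmove r hr (by omega) (by omega)]
      exact hagree r hr (by omega)

theorem AgreesBelow.move_ordExcDegZero {c : ℕ} {μ f : ℕ → ℕ} {T : ℕ} (h : AgreesBelow c μ f T)
    (m : Move c f) (hreg : m.Regular μ) (hT : m.endPos < T) : m.OrdExcDegZero := by
  cases m with
  | ordinary s t w hm =>
    change IsCap c μ s t at hreg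
    change w = 0
    have h1 := hm.degEq
    have h2 := hreg.2.degEq
    rw [lval_congr fun q hq hqr => h.cap s t hreg hT q hq.le hqr] at h1
    omega
  | tail t w hm => trivial
  | exceptional s t w hm =>
    change IsFree c μ t at hreg
    change w = 0
    have h1 := hm.degEq
    have h2 := hreg.lval_nonpos hm.lt
    rw [lval_congr fun q hq hqr => h.free t hreg hT hm.endZero q (by omega) hqr] at h1
    omega

theorem DPath.ordExcDegZero_of_agreesBelow {c : ℕ} {μ : ℕ → ℕ} (hμ : IsWeightDiagram μ)
    {f g : ℕ → ℕ} (p : DPath c f g) {T : ℕ} (h : AgreesBelow c μ f T)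
    (hdec : (T :: p.ends).IsChain (· > ·)) (hreg : p.RegularFrom μ) : p.OrdExcDegZero := by
  induction p generalizing T with
  | nil f => trivial
  | cons m p ih =>
    obtain ⟨hm, hp⟩ := hreg
    obtain ⟨hT, hdec⟩ := List.isChain_cons_cons.mp hdec
    exact ⟨h.move_ordExcDegZero m hm hT, ih (h.target hμ m hm hT) hdec hp⟩

/-- in any regular decreasing path in `D`, every edge given by an ordinary
legal move and every edge given by an exceptional move has degree `0`. -/
theorem regular_path_ord_exc_deg_zero (c : ℕ) (hc : c ≤ 1) (mu lam : ℕ → ℕ)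
    (hmu : IsWeightDiagram mu) (hlam : IsWeightDiagram lam)
    (p : DPath c mu lam) (hdec : p.Decreasing) (hreg : p.RegularFrom mu) :
    p.OrdExcDegZero := by
  cases p with
  | nil => trivial
  | cons m p =>
    exact DPath.ordExcDegZero_of_agreesBelow hmu _ (AgreesBelow.refl c mu (m.endPos + 1))
      (List.isChain_cons_cons.mpr ⟨Nat.lt_succ_self _, hdec⟩) hreg
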